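/- Let r ≤ s. The orbit map g ↦ g·(X₀,Y₀) from G = GL(r,ℂ) × GL(s,ℂ) to GSV(r,s) is surjective, i.e., GSV(r,s) equals the orbit of (X₀,Y₀). -/

import Mathlib

open Matrix

/-- The base point `X₀ = (I_r | 0)`. -/
def X0 (r s : ℕ) : Matrix (Fin r) (Fin s) ℂ :=
  fun i j => if (j : ℕ) = (i : ℕ) then 1 else 0

/-- The base point `Y₀ = (I_r ; 0)`. -/
def Y0 (r s : ℕ) : Matrix (Fin s) (Fin r) ℂ :=
  fun i j => if (i : ℕ) = (j : ℕ) then 1 else 0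

theorem gsv_is_orbit (r s : ℕ) (hr : 0 < r) (hrs : r ≤ s)
    (X : Matrix (Fin r) (Fin s) ℂ) (Y : Matrix (Fin s) (Fin r) ℂ) (h : X * Y = 1) :
    ∃ (A : GL (Fin r) ℂ) (B : GL (Fin s) ℂ),
      (A : Matrix (Fin r) (Fin r) ℂ) * X0 r s * ((B⁻¹ : GL (Fin s) ℂ) : Matrix (Fin s) (Fin s) ℂ) = X ∧
      (B : Matrix (Fin s) (Fin s) ℂ) * Y0 r s * ((A⁻¹ : GL (Fin r) ℂ) : Matrix (Fin r) (Fin r) ℂ) = Y := by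
  obtain ⟨k, rfl⟩ := Nat.exists_eq_add_of_le hrs
  have hsurj : Function.Surjective X.mulVecLin := fun v => ⟨Y *ᵥ v, by simp [h]⟩
  have hk : Module.finrank ℂ (LinearMap.ker X.mulVecLin) = k := by
    have h1 := LinearMap.finrank_range_add_finrank_ker X.mulVecLin
    rw [LinearMap.range_eq_top.2 hsurj, finrank_top] at h1
    simp only [Module.finrank_fin_fun] at h1
    omega
  let b := Module.finBasisOfFinrankEq ℂ (LinearMap.ker X.mulVecLin) hk
  let N : Matrix (Fin (r + k)) (Fin k) ℂ := fun i j => (b j : Fin (r + k) → ℂ) i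
  have hXN : X * N = 0 := by
    ext i j
    exact congrFun (LinearMap.mem_ker.1 (b j).2) i
  have hNinj : ∀ v, N *ᵥ v = 0 → v = 0 := by
    intro v hv
    have hli : LinearIndependent ℂ (fun j => (b j : Fin (r + k) → ℂ)) :=
      b.linearIndependent.map' (Submodule.subtype _) (Submodule.ker_subtype _)
    funext j
    refine Fintype.linearIndependent_iff.1 hli v ?_ j
    funext i
    have := congrFun hv i
    simpa [Matrix.mulVec, dotProduct, N, mul_comm] using this
  let e := (finSumFinEquiv : Fin r ⊕ Fin k ≃ Fin (r + k))
  let B : Matrix (Fin (r + k)) (Fin (r + k)) ℂ := (fromCols Y N).submatrix id e.symm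
  have hX0 : X0 r (r + k) = (fromCols (1 : Matrix (Fin r) (Fin r) ℂ) (0 : Matrix (Fin r) (Fin k) ℂ)).submatrix id e.symm := by
    ext i j
    obtain ⟨j, rfl⟩ := e.surjective j
    rcases j with j | j
    · simp [X0, e, Matrix.one_apply, Fin.ext_iff, eq_comm]
    · have hne : ¬ (r + (j : ℕ) = (i : ℕ)) := by have := i.2; omega
      simp [X0, e, hne]
  have hY0 : Y0 r (r + k) = (fromRows (1 : Matrix (Fin r) (Fin r) ℂ) (0 : Matrix (Fin k) (Fin r) ℂ)).submatrix e.symm id := by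
    ext j i
    obtain ⟨j, rfl⟩ := e.surjective j
    rcases j with j | j
    · by_cases hh : (j : ℕ) = (i : ℕ) <;> simp [Y0, e, Matrix.one_apply, Fin.ext_iff, hh]
    · have hne : ¬ (r + (j : ℕ) = (i : ℕ)) := by have := i.2; omega
      simp [Y0, e, hne]
  have hXB : X * B = X0 r (r + k) := by
    rw [hX0, ← h, ← hXN, ← mul_fromCols]
    rfl
  have hBY : B * Y0 r (r + k) = Y := by
    rw [hY0]
    simp only [B]
    rw [submatrix_mul_equiv, fromCols_mul_fromRows]
    simp
  have hinj : Function.Injective B.mulVec := by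
    refine (injective_iff_map_eq_zero B.mulVecLin).2 ?_
    intro v hv
    have hv' : fromCols Y N *ᵥ (v ∘ e) = 0 := by
      have := Matrix.submatrix_mulVec_equiv (fromCols Y N) v id e.symm
      simp only [Equiv.symm_symm] at this
      rw [Matrix.mulVecLin_apply] at hv
      simpa [B, hv] using this.symm.trans hv
    rw [fromCols_mulVec] at hv'
    have h1 : (v ∘ e) ∘ Sum.inl = 0 := by
      have := congrArg (X *ᵥ ·) hv'
      simpa [mulVec_add, h, hXN] using this
    have h2 : (v ∘ e) ∘ Sum.inr = 0 := by
      apply hNinj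
      simpa [h1] using hv'
    funext j
    obtain ⟨j, rfl⟩ := e.surjective j
    rcases j with j | j
    · exact congrFun h1 j
    · exact congrFun h2 j
  obtain ⟨u, hu⟩ := Matrix.mulVec_injective_iff_isUnit.1 hinj
  refine ⟨1, u, ?_, ?_⟩
  · rw [← hXB, ← hu]
    simp [Matrix.mul_assoc]
  · rw [hu]
    simpa using hBY
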